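/- arXiv:2011.00658 — 6 statements merged into one kernel-verified Lean document; each statement's English description precedes it below -/
import Mathlib

section
/- Let U_1,…,U_N : [0,∞) → ℂ^{d×d} be a solution of the Lohe matrix model with frustration, with initial data satisfying U_j(0) U_j(0)* = I_d for every j = 1,…,N. Then U_j(t) U_j(t)* = I_d for all t ≥ 0 and all j = 1,…,N; that is, unitarity is conserved along the flow. -/
open Matrix Finset

/-- A linear matrix flow `W' = A W` with skew-adjoint coefficient conserves `Wᴴ W`. -/
theorem conjTranspose_mul_self_eq_of_skewAdjoint_flow {n : Type*} [Fintype n]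
    {A W : ℝ → Matrix n n ℂ}
    (hA : ∀ t, 0 ≤ t → (A t)ᴴ = -A t)
    (hW : ∀ t, 0 ≤ t → ∀ a b, HasDerivAt (fun s => W s a b) ((A t * W t) a b) t)
    {t : ℝ} (ht : 0 ≤ t) : (W t)ᴴ * W t = (W 0)ᴴ * W 0 := by
  ext a b
  have hderiv : ∀ s, 0 ≤ s → HasDerivAt (fun s => ((W s)ᴴ * W s) a b) 0 s := by
    intro s hs
    have hsum : HasDerivAt (fun s => ∑ c, star (W s c a) * W s c b)
        (∑ c, (star ((A s * W s) c a) * W s c b + star (W s c a) * (A s * W s) c b)) s :=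
      HasDerivAt.fun_sum fun c _ => (hW s hs c a).star.mul (hW s hs c b)
    have hzero : (A s * W s)ᴴ * W s + (W s)ᴴ * (A s * W s) = 0 := by
      rw [conjTranspose_mul, hA s hs, Matrix.mul_neg, Matrix.neg_mul, Matrix.mul_assoc,
        neg_add_cancel]
    have hentry := congrFun (congrFun hzero a) b
    rw [Matrix.add_apply, Matrix.mul_apply, Matrix.mul_apply, ← sum_add_distrib] at hentry
    rw [← Matrix.zero_apply (α := ℂ) a b, ← hentry]
    exact hsum
  exact constant_of_has_deriv_right_zero
    (fun s hs => (hderiv s hs.1).continuousAt.continuousWithinAt)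
    (fun s hs => (hderiv s hs.1).hasDerivWithinAt) t ⟨ht, le_rfl⟩

/-- **Conservation of unitarity for the Lohe matrix model with frustration.**
If `U_1, …, U_N : [0,∞) → ℂ^{d×d}` solve
`U_j' = -i H_j U_j + (κ/(2N)) ∑_k (V U_k U_j* - U_j U_k* V*) U_j`
with Hermitian `H_j`, unitary frustration `V`, coupling `κ > 0`, and the
initial data satisfy `U_j(0) U_j(0)* = I`, then `U_j(t) U_j(t)* = I` for all `t ≥ 0`. -/
theorem lohe_matrix_unitarity_conserved {d N : ℕ} (hN : 1 ≤ N)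
    (κ : ℝ) (hκ : 0 < κ)
    (H : Fin N → Matrix (Fin d) (Fin d) ℂ) (hH : ∀ j, (H j).IsHermitian)
    (V : Matrix (Fin d) (Fin d) ℂ) (hV : V ∈ Matrix.unitaryGroup (Fin d) ℂ)
    (U : Fin N → ℝ → Matrix (Fin d) (Fin d) ℂ)
    (hode : ∀ (j : Fin N) (t : ℝ), 0 ≤ t → ∀ (a b : Fin d),
      HasDerivAt (fun s => U j s a b)
        (((-Complex.I) • (H j * U j t)
          + ((κ / (2 * N) : ℝ)) •
            ((∑ k : Fin N, (V * U k t * (U j t)ᴴ - U j t * (U k t)ᴴ * Vᴴ)) * U j t)) a b) t)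
    (hinit : ∀ j, U j 0 * (U j 0)ᴴ = 1) :
    ∀ (j : Fin N) (t : ℝ), 0 ≤ t → U j t * (U j t)ᴴ = 1 := by
  intro j t ht
  have hflow := conjTranspose_mul_self_eq_of_skewAdjoint_flow (W := U j)
    (A := fun t => (-Complex.I) • H j + ((κ / (2 * N) : ℝ)) •
      ∑ k : Fin N, (V * U k t * (U j t)ᴴ - U j t * (U k t)ᴴ * Vᴴ)) ?_ ?_ ht
  · rw [mul_eq_one_comm, hflow, mul_eq_one_comm]
    exact hinit j
  · intro s _
    simp only [conjTranspose_add, conjTranspose_neg, conjTranspose_smul, conjTranspose_sum,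
      conjTranspose_sub, conjTranspose_mul, conjTranspose_conjTranspose, (hH j).eq, Complex.star_def,
      Complex.conj_I, star_trivial, neg_add, neg_smul, neg_neg, ← smul_neg, ← sum_neg_distrib,
      neg_sub, Matrix.mul_assoc]
  · intro s hs a b
    simpa only [Matrix.add_mul, Matrix.smul_mul] using hode j s hs a b
end

section
/- Let Θ = (θ_1,…,θ_N) be a solution of the cosine-Kuramoto model with frustration α = 0. Then the functional 𝓘(Θ) := ∏_{i=1}^N sin((θ_{i+1} − θ_i)/2), with the convention θ_{N+1} = θ_1, is time-invariant: 𝓘(Θ(t)) = 𝓘(Θ(0)) for all t ≥ 0. -/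
open Finset

/-- A finite product whose factors have logarithmic derivatives `g i` summing to zero is
stationary. -/
lemma hasDerivAt_prod_zero_of_sum_eq_zero {ι : Type*} [Fintype ι] {f : ι → ℝ → ℝ} {g : ι → ℝ}
    {t : ℝ} (hf : ∀ i, HasDerivAt (f i) (f i t * g i) t) (hg : ∑ i, g i = 0) :
    HasDerivAt (fun s => ∏ i, f i s) 0 t := by
  classical
  refine (HasDerivAt.fun_finsetProd (u := univ) fun i _ => hf i).congr_deriv ?_
  calc ∑ i, (∏ j ∈ univ.erase i, f j t) • (f i t * g i)
      = ∑ i, (∏ j, f j t) * g i := by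
        refine sum_congr rfl fun i _ => ?_
        rw [← prod_erase_mul univ (fun j => f j t) (mem_univ i), smul_eq_mul, mul_assoc]
    _ = 0 := by rw [← mul_sum, hg, mul_zero]

lemma sum_sum_sin_sub_eq_zero {ι : Type*} [Fintype ι] (x : ι → ℝ) :
    ∑ i, ∑ k, Real.sin (x k - x i) = 0 := by
  have h : ∑ i, ∑ k, Real.sin (x k - x i) = -∑ i, ∑ k, Real.sin (x k - x i) := by
    conv_lhs => rw [sum_comm]
    simp_rw [← sum_neg_distrib, ← Real.sin_neg, neg_sub]
  linarith

lemma cos_half_sub_mul_cos_sub_cos (a b c : ℝ) :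
    Real.cos ((b - a) / 2) * (Real.cos (c - b) - Real.cos (c - a)) =
      Real.sin ((b - a) / 2) * (Real.sin (c - a) + Real.sin (c - b)) := by
  have hb : c - b = (c - (a + b) / 2) - (b - a) / 2 := by ring
  have ha : c - a = (c - (a + b) / 2) + (b - a) / 2 := by ring
  rw [hb, ha]
  generalize c - (a + b) / 2 = d, (b - a) / 2 = e
  rw [Real.cos_sub, Real.cos_add, Real.sin_add, Real.sin_sub]
  ring

/-- **Invariance of `𝓘(Θ) = ∏ᵢ sin((θ_{i+1} - θ_i)/2)` for the cosine-Kuramoto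
flow with zero frustration.** Here the index `i + 1` is taken cyclically in `Fin N`
(i.e. `θ_{N+1} = θ_1`). -/
theorem kuramoto_cosine_I_invariant {N : ℕ} [NeZero N] (κ : ℝ) (hκ : 0 < κ)
    (θ : Fin N → ℝ → ℝ)
    (hode : ∀ (j : Fin N) (t : ℝ), 0 ≤ t →
      HasDerivAt (θ j) ((κ / N) * ∑ k : Fin N, Real.cos (θ k t - θ j t)) t)
    (t : ℝ) (ht : 0 ≤ t) :
    ∏ i : Fin N, Real.sin ((θ (i + 1) t - θ i t) / 2)
      = ∏ i : Fin N, Real.sin ((θ (i + 1) 0 - θ i 0) / 2) := by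
  have key : ∀ s, 0 ≤ s →
      HasDerivAt (fun s => ∏ i : Fin N, Real.sin ((θ (i + 1) s - θ i s) / 2)) 0 s := by
    intro s hs
    refine hasDerivAt_prod_zero_of_sum_eq_zero
      (g := fun i => κ / N / 2 * (∑ k, Real.sin (θ k s - θ i s) +
        ∑ k, Real.sin (θ k s - θ (i + 1) s))) (fun i => ?_) ?_
    · refine (((hode (i + 1) s hs).sub (hode i s hs)).div_const 2).sin.congr_deriv ?_
      have h := sum_congr rfl fun k (_ : k ∈ univ) =>
        cos_half_sub_mul_cos_sub_cos (θ i s) (θ (i + 1) s) (θ k s)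
      rw [← mul_sum, ← mul_sum, sum_sub_distrib, sum_add_distrib] at h
      simp only [Pi.sub_apply]
      linear_combination (κ / N / 2) * h
    · have hshift : ∑ i, ∑ k, Real.sin (θ k s - θ (i + 1) s) =
          ∑ i, ∑ k, Real.sin (θ k s - θ i s) :=
        Equiv.sum_comp (Equiv.addRight (1 : Fin N)) fun i => ∑ k, Real.sin (θ k s - θ i s)
      rw [← mul_sum, sum_add_distrib, hshift, sum_sum_sin_sub_eq_zero fun i => θ i s]
      simp
  exact constant_of_has_deriv_right_zero
    (fun s hs => (key s hs.1).continuousAt.continuousWithinAt)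
    (fun s hs => (key s hs.1).hasDerivWithinAt) t ⟨ht, le_rfl⟩
end

section
/- Let N ≥ 4 and let Θ = (θ_1,…,θ_N) be a solution of the cosine-Kuramoto model with frustration α satisfying |α| ≤ π/2, whose initial phases are pairwise distinct modulo 2π, i.e. θ_i(0) ≢ θ_j(0) (mod 2π) for all 1 ≤ i ≠ j ≤ N. Then for any four distinct indices a, b, c, d ∈ {1,…,N}, the cross-ratio 𝓚_{abcd}(Θ) := (Δθ_{ab} · Δθ_{cd}) / (Δθ_{ac} · Δθ_{bd}), where Δθ_{pq} := sin((θ_p − θ_q)/2), is time-invariant: 𝓚_{abcd}(Θ(t)) = 𝓚_{abcd}(Θ(0)) for all t ≥ 0. -/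
open Finset

/-- Solutions of a scalar linear equation `f' = g f` on `[0, ∞)`, with `g` continuous there,
are given by an exponential integrating factor. -/
theorem eq_mul_exp_integral_of_hasDerivAt {f g : ℝ → ℝ} (hg : ContinuousOn g (Set.Ici 0))
    (hf : ∀ t, 0 ≤ t → HasDerivAt f (g t * f t) t) {t : ℝ} (ht : 0 ≤ t) :
    f t = f 0 * Real.exp (∫ s in (0 : ℝ)..t, g (max s 0)) := by
  have hcont : Continuous fun s => g (max s 0) :=
    hg.comp_continuous (continuous_id.max continuous_const) fun s => le_max_right s 0
  have hderiv : ∀ x, 0 ≤ x → HasDerivAt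
      (fun x => f x * Real.exp (-∫ s in (0 : ℝ)..x, g (max s 0))) 0 x := by
    intro x hx
    have hI := (hcont.integral_hasStrictDerivAt 0 x).hasDerivAt
    refine ((hf x hx).mul hI.neg.exp).congr_deriv ?_
    simp only [max_eq_left hx, Pi.neg_apply]
    ring
  have hconst := constant_of_has_deriv_right_zero
    (fun x hx => (hderiv x hx.1).continuousAt.continuousWithinAt)
    (fun x hx => (hderiv x hx.1).hasDerivWithinAt) t (Set.right_mem_Icc.2 ht)
  simp only [intervalIntegral.integral_same, neg_zero, Real.exp_zero, mul_one] at hconst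
  rw [← hconst, mul_assoc, ← Real.exp_add, neg_add_cancel, Real.exp_zero, mul_one]

theorem cos_sub_cos_mul_cos_half_sub (x p q : ℝ) :
    (Real.cos (x - p) - Real.cos (x - q)) * Real.cos ((p - q) / 2) =
      (Real.sin (x - p) + Real.sin (x - q)) * Real.sin ((p - q) / 2) := by
  have hp : x - p = x - (p + q) / 2 - (p - q) / 2 := by ring
  have hq : x - q = x - (p + q) / 2 + (p - q) / 2 := by ring
  rw [hp, hq, Real.cos_sub (x - _), Real.cos_add, Real.sin_sub (x - _), Real.sin_add]
  ring

/-- Along a solution of the cosine-Kuramoto model, each half-angle sine is multiplied by a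
product of two nonzero factors, each depending on a single oscillator. -/
theorem exists_sin_half_sub_eq_mul {N : ℕ} {κ α : ℝ} {θ : Fin N → ℝ → ℝ}
    (hode : ∀ (j : Fin N) (t : ℝ), 0 ≤ t →
      HasDerivAt (θ j) ((κ / N) * ∑ k : Fin N, Real.cos (θ k t - θ j t + α)) t)
    {t : ℝ} (ht : 0 ≤ t) :
    ∃ E : Fin N → ℝ, (∀ p, E p ≠ 0) ∧ ∀ p q,
      Real.sin ((θ p t - θ q t) / 2) = Real.sin ((θ p 0 - θ q 0) / 2) * (E p * E q) := by
  let g : Fin N → ℝ → ℝ := fun p s =>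
    (κ / N) * (∑ k : Fin N, Real.sin (θ k s - θ p s + α)) / 2
  have hθ : ∀ j, ContinuousOn (θ j) (Set.Ici 0) := fun j s hs =>
    (hode j s hs).continuousAt.continuousWithinAt
  have hg : ∀ p, ContinuousOn (g p) (Set.Ici 0) := fun p => by
    dsimp only [g]
    fun_prop
  have hgc : ∀ p, Continuous fun s => g p (max s 0) := fun p =>
    (hg p).comp_continuous (continuous_id.max continuous_const) fun s => le_max_right s 0
  refine ⟨fun p => Real.exp (∫ s in (0 : ℝ)..t, g p (max s 0)), fun p => Real.exp_ne_zero _,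
    fun p q => ?_⟩
  rw [← Real.exp_add, ← intervalIntegral.integral_add ((hgc p).intervalIntegrable _ _)
    ((hgc q).intervalIntegrable _ _)]
  refine eq_mul_exp_integral_of_hasDerivAt (f := fun s => Real.sin ((θ p s - θ q s) / 2))
    (g := fun s => g p s + g q s) ((hg p).add (hg q)) (fun s hs => ?_) ht
  refine (((hode p s hs).sub (hode q s hs)).div_const 2).sin.congr_deriv ?_
  have hsum : (∑ k, Real.cos (θ k s - θ p s + α) - ∑ k, Real.cos (θ k s - θ q s + α)) *
        Real.cos ((θ p s - θ q s) / 2) =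
      (∑ k, Real.sin (θ k s - θ p s + α) + ∑ k, Real.sin (θ k s - θ q s + α)) *
        Real.sin ((θ p s - θ q s) / 2) := by
    rw [← sum_sub_distrib, ← sum_add_distrib, sum_mul, sum_mul]
    refine sum_congr rfl fun k _ => ?_
    simp only [sub_add_eq_add_sub]
    exact cos_sub_cos_mul_cos_half_sub _ _ _
  simp only [g, Pi.sub_apply]
  linear_combination (κ / N / 2) * hsum

/-- **Invariance of the cross-ratio `𝓚_{abcd}(Θ)` for the cosine-Kuramoto
model with frustration `|α| ≤ π/2`.** Here `Δθ_{pq} = sin((θ_p - θ_q)/2)` and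
`𝓚_{abcd} = (Δθ_{ab}·Δθ_{cd})/(Δθ_{ac}·Δθ_{bd})`. -/
theorem kuramoto_cosine_crossratio_invariant {N : ℕ} (hN : 4 ≤ N)
    (κ α : ℝ) (hκ : 0 < κ) (hα : |α| ≤ Real.pi / 2)
    (θ : Fin N → ℝ → ℝ)
    (hode : ∀ (j : Fin N) (t : ℝ), 0 ≤ t →
      HasDerivAt (θ j) ((κ / N) * ∑ k : Fin N, Real.cos (θ k t - θ j t + α)) t)
    (hinit : ∀ i j : Fin N, i ≠ j → ∀ k : ℤ, θ i 0 - θ j 0 ≠ 2 * Real.pi * k)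
    (a b c d : Fin N)
    (hab : a ≠ b) (hac : a ≠ c) (had : a ≠ d)
    (hbc : b ≠ c) (hbd : b ≠ d) (hcd : c ≠ d)
    (t : ℝ) (ht : 0 ≤ t) :
    (Real.sin ((θ a t - θ b t) / 2) * Real.sin ((θ c t - θ d t) / 2))
        / (Real.sin ((θ a t - θ c t) / 2) * Real.sin ((θ b t - θ d t) / 2))
      = (Real.sin ((θ a 0 - θ b 0) / 2) * Real.sin ((θ c 0 - θ d 0) / 2))
        / (Real.sin ((θ a 0 - θ c 0) / 2) * Real.sin ((θ b 0 - θ d 0) / 2)) := by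
  obtain ⟨E, hE, h⟩ := exists_sin_half_sub_eq_mul hode ht
  rw [h a b, h c d, h a c, h b d,
    mul_mul_mul_comm, mul_mul_mul_comm (Real.sin _) _ (Real.sin _),
    mul_mul_mul_comm (E a) (E b), mul_div_mul_right _ _
      (mul_ne_zero (mul_ne_zero (hE a) (hE c)) (mul_ne_zero (hE b) (hE d)))]
end

section
/- Let Θ = (θ_1,…,θ_N) be a solution of the sine-Kuramoto model with frustration α, and let 1 ≤ m ≤ N be such that for all t ≥ 0, θ_j(t) = θ_N(t) for j = N−m+1,…,N, while θ_j(t) ≢ θ_N(t) (mod 2π) for j = 1,…,N−m. Define x_j(t) := (1 + cos(θ_j(t) − θ_N(t))) / sin(θ_j(t) − θ_N(t)) for j = 1,…,N−m. Then for each j = 1,…,N−m and all t > 0, x_j'(t) = 𝓐(t) + 𝓑(t) x_j(t), where 𝓐 = (κ/N)[ m sin α + Σ_{k=1}^{N−m} ( (2 x_k/(x_k² + 1)) cos α + ((x_k² − 1)/(x_k² + 1)) sin α ) ] and 𝓑 = (κ/N)[ m cos α + Σ_{k=1}^{N−m} ( −(2 x_k/(x_k² + 1)) sin α + ((x_k²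 − 1)/(x_k² + 1)) cos α ) ]. -/
open Finset

/-- The stereographic variable is the cotangent of the half angle, even where
both quotients are given by the convention `a / 0 = 0`. -/
lemma one_add_cos_div_sin_eq (φ : ℝ) :
    (1 + Real.cos φ) / Real.sin φ = Real.cos (φ / 2) / Real.sin (φ / 2) := by
  have hc : Real.cos φ = 2 * Real.cos (φ / 2) ^ 2 - 1 := by
    rw [← Real.cos_two_mul]; ring_nf
  have hs : Real.sin φ = 2 * Real.sin (φ / 2) * Real.cos (φ / 2) := by
    rw [← Real.sin_two_mul]; ring_nf
  rw [hc, hs]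
  by_cases h0 : Real.cos (φ / 2) = 0
  · simp [h0]
  by_cases h1 : Real.sin (φ / 2) = 0
  · simp [h1]
  field_simp
  ring

lemma sin_half_ne_zero {φ : ℝ} (h : ∀ k : ℤ, φ ≠ 2 * Real.pi * k) :
    Real.sin (φ / 2) ≠ 0 := by
  intro h0
  obtain ⟨k, hk⟩ := Real.sin_eq_zero_iff.mp h0
  exact h k (by linarith)

/-- The sine in terms of the cotangent of the half angle. -/
lemma two_mul_cot_half_div {φ : ℝ} (h : Real.sin (φ / 2) ≠ 0) :
    2 * (Real.cos (φ / 2) / Real.sin (φ / 2)) /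
      ((Real.cos (φ / 2) / Real.sin (φ / 2)) ^ 2 + 1) = Real.sin φ := by
  have hs : Real.sin φ = 2 * Real.sin (φ / 2) * Real.cos (φ / 2) := by
    rw [← Real.sin_two_mul]; ring_nf
  have hd : (Real.cos (φ / 2) / Real.sin (φ / 2)) ^ 2 + 1 = 1 / Real.sin (φ / 2) ^ 2 := by
    field_simp
    linarith [Real.sin_sq_add_cos_sq (φ / 2)]
  rw [hd, hs]
  field_simp

/-- The cosine in terms of the cotangent of the half angle. -/
lemma cot_half_sq_sub_one_div {φ : ℝ} (h : Real.sin (φ / 2) ≠ 0) :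
    ((Real.cos (φ / 2) / Real.sin (φ / 2)) ^ 2 - 1) /
      ((Real.cos (φ / 2) / Real.sin (φ / 2)) ^ 2 + 1) = Real.cos φ := by
  have hc : Real.cos φ = Real.cos (φ / 2) ^ 2 - Real.sin (φ / 2) ^ 2 := by
    rw [← Real.cos_two_mul']; ring_nf
  have hd : (Real.cos (φ / 2) / Real.sin (φ / 2)) ^ 2 + 1 = 1 / Real.sin (φ / 2) ^ 2 := by
    field_simp
    linarith [Real.sin_sq_add_cos_sq (φ / 2)]
  rw [hd, hc]
  field_simp

lemma hasDerivAt_cot_half {φ : ℝ → ℝ} {φ' t : ℝ} (hφ : HasDerivAt φ φ' t)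
    (h : Real.sin (φ t / 2) ≠ 0) :
    HasDerivAt (fun s => Real.cos (φ s / 2) / Real.sin (φ s / 2))
      (-φ' / (2 * Real.sin (φ t / 2) ^ 2)) t := by
  have h2 : HasDerivAt (fun s => φ s / 2) (φ' / 2) t := hφ.div_const 2
  refine (h2.cos.fun_div h2.sin h).congr_deriv ?_
  field_simp
  linear_combination (-φ') * Real.sin_sq_add_cos_sq (φ t / 2)

/-- The contribution of an oscillator with phase difference `ψ` to the derivative of the
stereographic variable of an oscillator with phase difference `φ`. -/
lemma sin_add_sub_sin_sub_add_div {φ : ℝ} (h : Real.sin (φ / 2) ≠ 0) (ψ α : ℝ) :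
    (Real.sin (ψ + α) - Real.sin (ψ - φ + α)) / (2 * Real.sin (φ / 2) ^ 2) =
      Real.sin (ψ + α) + Real.cos (ψ + α) * (Real.cos (φ / 2) / Real.sin (φ / 2)) := by
  have hs : Real.sin φ = 2 * Real.sin (φ / 2) * Real.cos (φ / 2) := by
    rw [← Real.sin_two_mul]; ring_nf
  have hc : Real.cos φ = 1 - 2 * Real.sin (φ / 2) ^ 2 := by
    rw [← Real.cos_two_mul_eq_one_sub]; ring_nf
  rw [show ψ - φ + α = (ψ + α) - φ by ring, Real.sin_sub, hs, hc]
  field_simp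
  ring

lemma sum_Icc_eq_mul_add_sum {N m : ℕ} (hm : m ≤ N) (f : ℕ → ℝ) (c : ℝ)
    (hf : ∀ k ∈ Finset.Icc (N - m + 1) N, f k = c) :
    ∑ k ∈ Finset.Icc 1 N, f k = m * c + ∑ k ∈ Finset.Icc 1 (N - m), f k := by
  have hu : Finset.Icc 1 N = Finset.Icc (N - m + 1) N ∪ Finset.Icc 1 (N - m) := by
    ext k
    simp only [Finset.mem_union, Finset.mem_Icc]
    omega
  have hd : Disjoint (Finset.Icc (N - m + 1) N) (Finset.Icc 1 (N - m)) := by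
    rw [Finset.disjoint_left]
    intro k
    simp only [Finset.mem_Icc]
    omega
  rw [hu, Finset.sum_union hd, Finset.sum_congr rfl hf, Finset.sum_const, Nat.card_Icc,
    nsmul_eq_mul, show N + 1 - (N - m + 1) = m by omega]

/-- **Low-dimensional reduction of the sine-Kuramoto model with frustration.**
Oscillators are indexed by `j ∈ {1, …, N}`. If `θ_j ≡ θ_N` for
`j = N-m+1, …, N` while `θ_j ≢ θ_N (mod 2π)` for `j = 1, …, N-m`, then the
stereographic variables `x_j = (1 + cos(θ_j - θ_N))/sin(θ_j - θ_N)` satisfy the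
affine system `x_j' = 𝓐 + 𝓑 x_j`. -/
theorem kuramoto_stereographic_reduction (N m : ℕ) (hN : 3 ≤ N)
    (hm₁ : 1 ≤ m) (hm₂ : m ≤ N) (κ α : ℝ) (hκ : 0 < κ)
    (θ : ℕ → ℝ → ℝ)
    (hode : ∀ j ∈ Finset.Icc 1 N, ∀ t : ℝ, 0 ≤ t →
      HasDerivAt (θ j) ((κ / N) * ∑ k ∈ Finset.Icc 1 N, Real.sin (θ k t - θ j t + α)) t)
    (heq : ∀ j ∈ Finset.Icc (N - m + 1) N, ∀ t : ℝ, 0 ≤ t → θ j t = θ N t)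
    (hne : ∀ j ∈ Finset.Icc 1 (N - m), ∀ t : ℝ, 0 ≤ t →
      ∀ k : ℤ, θ j t - θ N t ≠ 2 * Real.pi * k)
    (x : ℕ → ℝ → ℝ)
    (hx : ∀ (j : ℕ) (t : ℝ),
      x j t = (1 + Real.cos (θ j t - θ N t)) / Real.sin (θ j t - θ N t))
    (A B : ℝ → ℝ)
    (hA : ∀ t : ℝ, A t = (κ / N) * ((m : ℝ) * Real.sin α
      + ∑ k ∈ Finset.Icc 1 (N - m),
        ((2 * x k t / ((x k t) ^ 2 + 1)) * Real.cos α
          + (((x k t) ^ 2 - 1) / ((x k t) ^ 2 + 1)) * Real.sin α)))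
    (hB : ∀ t : ℝ, B t = (κ / N) * ((m : ℝ) * Real.cos α
      + ∑ k ∈ Finset.Icc 1 (N - m),
        (-(2 * x k t / ((x k t) ^ 2 + 1)) * Real.sin α
          + (((x k t) ^ 2 - 1) / ((x k t) ^ 2 + 1)) * Real.cos α))) :
    ∀ j ∈ Finset.Icc 1 (N - m), ∀ t : ℝ, 0 < t →
      HasDerivAt (x j) (A t + B t * x j t) t := by
  intro j hj t ht
  have hx' : ∀ k s, x k s = Real.cos ((θ k s - θ N s) / 2) / Real.sin ((θ k s - θ N s) / 2) :=
    fun k s => (hx k s).trans (one_add_cos_div_sin_eq _)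
  have hs : ∀ k ∈ Finset.Icc 1 (N - m), Real.sin ((θ k t - θ N t) / 2) ≠ 0 :=
    fun k hk => sin_half_ne_zero (hne k hk t ht.le)
  have hAsum : A t = (κ / N) * ∑ k ∈ Finset.Icc 1 N, Real.sin (θ k t - θ N t + α) := by
    rw [hA, sum_Icc_eq_mul_add_sum hm₂ _ (Real.sin α)
      (fun k hk => by rw [heq k hk t ht.le, sub_self, zero_add])]
    congr 2
    refine Finset.sum_congr rfl fun k hk => ?_
    rw [hx', two_mul_cot_half_div (hs k hk), cot_half_sq_sub_one_div (hs k hk), Real.sin_add]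
  have hBsum : B t = (κ / N) * ∑ k ∈ Finset.Icc 1 N, Real.cos (θ k t - θ N t + α) := by
    rw [hB, sum_Icc_eq_mul_add_sum hm₂ _ (Real.cos α)
      (fun k hk => by rw [heq k hk t ht.le, sub_self, zero_add])]
    congr 2
    refine Finset.sum_congr rfl fun k hk => ?_
    rw [hx', two_mul_cot_half_div (hs k hk), cot_half_sq_sub_one_div (hs k hk), Real.cos_add]
    ring
  have hj' : j ∈ Finset.Icc 1 N := Finset.Icc_subset_Icc_right (Nat.sub_le N m) hj
  have hN' : N ∈ Finset.Icc 1 N := Finset.mem_Icc.mpr ⟨by omega, le_rfl⟩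
  have hd := hasDerivAt_cot_half ((hode j hj' t ht.le).fun_sub (hode N hN' t ht.le)) (hs j hj)
  rw [funext (hx' j)]
  refine hd.congr_deriv ?_
  rw [hAsum, hBsum, mul_assoc, ← mul_add, ← mul_sub, ← mul_neg, mul_div_assoc,
    Finset.sum_mul, ← Finset.sum_add_distrib, neg_sub, ← Finset.sum_sub_distrib,
    Finset.sum_div]
  congr 1
  refine Finset.sum_congr rfl fun k _ => ?_
  rw [← sin_add_sub_sin_sub_add_div (hs j hj)]
  ring_nf
end

section
/- Let U_1,…,U_N be a solution of the Lohe matrix model with identical Hamiltonian H and unitary frustration matrix V, with unitary initial data U_j(0) ∈ U(d). Suppose the frustration and initial data satisfy ‖V − I_d‖_F < 2/3 and max_{1 ≤ i,j ≤ N} ‖U_i(0) − U_j(0)‖_F < √(2 − 3‖V − I_d‖_F), where ‖·‖_F denotes the Frobenius norm. Then complete aggregation emerges asymptotically: max_{1 ≤ i,j ≤ N} ‖U_i(t) − U_j(t)‖_F → 0 as t → ∞. -/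
open Matrix Finset

/-- The Frobenius norm `‖A‖_F = √(tr(A A*)) = √(∑_{i,j} |A_{ij}|²)` of a complex
square matrix. -/
noncomputable def frobNorm {d : ℕ} (A : Matrix (Fin d) (Fin d) ℂ) : ℝ :=
  Real.sqrt (∑ i : Fin d, ∑ j : Fin d, Complex.normSq (A i j))

section Frobenius

variable {d : ℕ}

lemma re_trace_conjTranspose (A : Matrix (Fin d) (Fin d) ℂ) : Aᴴ.trace.re = A.trace.re := by
  simp [trace_conjTranspose]

lemma frobNorm_nonneg (A : Matrix (Fin d) (Fin d) ℂ) : 0 ≤ frobNorm A := Real.sqrt_nonneg _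

lemma sq_frobNorm_eq_sum (A : Matrix (Fin d) (Fin d) ℂ) :
    frobNorm A ^ 2 = ∑ i, ∑ j, Complex.normSq (A i j) :=
  Real.sq_sqrt (sum_nonneg fun _ _ => sum_nonneg fun _ _ => Complex.normSq_nonneg _)

lemma sq_frobNorm (A : Matrix (Fin d) (Fin d) ℂ) :
    frobNorm A ^ 2 = (Aᴴ * A).trace.re := by
  rw [sq_frobNorm_eq_sum, sum_comm]
  simp [trace, mul_apply, Complex.normSq_apply]

section

attribute [local instance] Matrix.frobeniusNormedAddCommGroup

lemma frobNorm_eq_norm (A : Matrix (Fin d) (Fin d) ℂ) : frobNorm A = ‖A‖ := by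
  simp [frobenius_norm_def, frobNorm, Real.sqrt_eq_rpow, Complex.normSq_eq_norm_sq]

lemma frobNorm_mul_le (A B : Matrix (Fin d) (Fin d) ℂ) :
    frobNorm (A * B) ≤ frobNorm A * frobNorm B := by
  simpa only [frobNorm_eq_norm] using frobenius_norm_mul A B

lemma frobNorm_conjTranspose (A : Matrix (Fin d) (Fin d) ℂ) : frobNorm Aᴴ = frobNorm A := by
  simpa only [frobNorm_eq_norm] using frobenius_norm_conjTranspose A

end

lemma frobNorm_sub_comm (A B : Matrix (Fin d) (Fin d) ℂ) :
    frobNorm (A - B) = frobNorm (B - A) := by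
  simp [frobNorm, ← Complex.normSq_neg (A _ _ - B _ _)]

/-- Cauchy–Schwarz for the Frobenius inner product. -/
lemma neg_mul_frobNorm_le_re_trace (A B : Matrix (Fin d) (Fin d) ℂ) :
    -(frobNorm A * frobNorm B) ≤ (Aᴴ * B).trace.re := by
  have h := Real.sum_mul_le_sqrt_mul_sqrt (univ ×ˢ univ : Finset (Fin d × Fin d))
    (fun p => ‖A p.1 p.2‖) (fun p => ‖B p.1 p.2‖)
  simp only [sum_product, ← Complex.normSq_eq_norm_sq] at h
  refine (neg_le_neg h).trans ?_
  have e : (Aᴴ * B).trace.re = ∑ i, ∑ j, (star (A i j) * B i j).re := by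
    rw [sum_comm]
    simp [trace, mul_apply]
  rw [e]
  simp only [← sum_neg_distrib]
  refine sum_le_sum fun i _ => sum_le_sum fun j _ => ?_
  have := Complex.abs_re_le_norm (star (A i j) * B i j)
  rw [norm_mul, norm_star] at this
  exact (abs_le.1 this).1

lemma frobNorm_unitary_mul {W : Matrix (Fin d) (Fin d) ℂ} (hW : Wᴴ * W = 1)
    (A : Matrix (Fin d) (Fin d) ℂ) : frobNorm (W * A) = frobNorm A := by
  rw [← sq_eq_sq₀ (frobNorm_nonneg _) (frobNorm_nonneg _), sq_frobNorm, sq_frobNorm,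
    conjTranspose_mul, Matrix.mul_assoc, ← Matrix.mul_assoc Wᴴ, hW, Matrix.one_mul]

lemma frobNorm_mul_unitary {W : Matrix (Fin d) (Fin d) ℂ} (hW : Wᴴ * W = 1)
    (A : Matrix (Fin d) (Fin d) ℂ) : frobNorm (A * W) = frobNorm A := by
  have hW' : Wᴴᴴ * Wᴴ = 1 := by rw [conjTranspose_conjTranspose]; exact mul_eq_one_comm.1 hW
  rw [← frobNorm_conjTranspose, conjTranspose_mul, frobNorm_unitary_mul hW',
    frobNorm_conjTranspose]

lemma sq_frobNorm_sub {A B : Matrix (Fin d) (Fin d) ℂ} (hA : Aᴴ * A = 1) (hB : Bᴴ * B = 1) :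
    frobNorm (A - B) ^ 2 = 2 * d - 2 * (Aᴴ * B).trace.re := by
  have h : (Bᴴ * A).trace.re = (Aᴴ * B).trace.re := by
    rw [← re_trace_conjTranspose]
    simp
  rw [sq_frobNorm, conjTranspose_sub]
  simp only [Matrix.sub_mul, Matrix.mul_sub, hA, hB, trace_sub, trace_one, Complex.sub_re, h]
  simp
  ring

/-- A lower bound on the numerical-range functional of a perturbed unitary matrix. -/
lemma re_trace_conj_unitary_add_ge {A : Matrix (Fin d) (Fin d) ℂ} (hA : Aᴴ * A = 1)
    (M Q : Matrix (Fin d) (Fin d) ℂ) :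
    frobNorm Q ^ 2 * (1 - frobNorm (A - 1) ^ 2 / 2 - frobNorm M)
      ≤ (Qᴴ * ((A + M) * Q)).trace.re := by
  have h1 : frobNorm ((A - 1) * Q) ^ 2
      = 2 * frobNorm Q ^ 2 - 2 * (Qᴴ * (A * Q)).trace.re := by
    have hs : (Qᴴ * (Aᴴ * Q)).trace.re = (Qᴴ * (A * Q)).trace.re := by
      rw [← re_trace_conjTranspose]
      simp [Matrix.mul_assoc]
    have e : ((A - 1) * Q)ᴴ * ((A - 1) * Q)
        = Qᴴ * (Aᴴ * A) * Q + Qᴴ * Q - Qᴴ * (A * Q) - Qᴴ * (Aᴴ * Q) := by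
      simp only [conjTranspose_mul, conjTranspose_sub, conjTranspose_one]
      noncomm_ring
    rw [sq_frobNorm, e, hA, Matrix.mul_one, sq_frobNorm]
    simp only [trace_sub, trace_add, Complex.sub_re, Complex.add_re, hs]
    ring
  have h2 : frobNorm ((A - 1) * Q) ^ 2 ≤ frobNorm (A - 1) ^ 2 * frobNorm Q ^ 2 := by
    rw [← mul_pow]
    exact pow_le_pow_left₀ (frobNorm_nonneg _) (frobNorm_mul_le _ _) 2
  have h3 := neg_mul_frobNorm_le_re_trace Q (M * Q)
  have h4 := mul_le_mul_of_nonneg_left (frobNorm_mul_le M Q) (frobNorm_nonneg Q)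
  rw [Matrix.add_mul, Matrix.mul_add, trace_add, Complex.add_re]
  nlinarith

/-- For unitary `A`, `B` with product `G`, the interaction trace is the pairing of `A + B` with
the positive semidefinite matrix `(1 - G) * (1 - G)ᴴ`. -/
lemma re_trace_interaction {A B : Matrix (Fin d) (Fin d) ℂ} (hA : Aᴴ * A = 1)
    (hB : Bᴴ * B = 1) :
    (A + B - A * B * B - A * (A * B)).trace.re
      = ((1 - A * B)ᴴ * (A * (1 - A * B))).trace.re
        + ((1 - A * B)ᴴ * (B * (1 - A * B))).trace.re := by
  have hA' : A * Aᴴ = 1 := mul_eq_one_comm.1 hA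
  have hB' : B * Bᴴ = 1 := mul_eq_one_comm.1 hB
  have hG : (1 - A * B) * (1 - A * B)ᴴ = 2 - A * B - Bᴴ * Aᴴ := by
    have e : (1 - A * B) * (1 - A * B)ᴴ = 1 - A * B - Bᴴ * Aᴴ + A * (B * Bᴴ) * Aᴴ := by
      simp only [conjTranspose_mul, conjTranspose_sub, conjTranspose_one]
      noncomm_ring
    rw [e, hB', Matrix.mul_one, hA', ← one_add_one_eq_two]
    abel
  have key (X : Matrix (Fin d) (Fin d) ℂ) : ((1 - A * B)ᴴ * (X * (1 - A * B))).trace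
      = 2 * X.trace - (X * (A * B)).trace - (X * (Bᴴ * Aᴴ)).trace := by
    rw [trace_mul_comm, Matrix.mul_assoc, hG, Matrix.mul_sub, Matrix.mul_sub, trace_sub, trace_sub,
      mul_two, trace_add, two_mul]
  have h1 : (A * (Bᴴ * Aᴴ)).trace = star B.trace := by
    rw [trace_mul_comm, Matrix.mul_assoc, hA, Matrix.mul_one, trace_conjTranspose]
  have h2 : (B * (Bᴴ * Aᴴ)).trace = star A.trace := by
    rw [← Matrix.mul_assoc, hB', Matrix.one_mul, trace_conjTranspose]
  rw [key, key, h1, h2, trace_mul_comm B (A * B)]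
  simp only [trace_sub, trace_add, Complex.sub_re, Complex.add_re, Complex.star_def,
    Complex.conj_re, Complex.mul_re, Complex.re_ofNat, Complex.im_ofNat]
  ring

/-- The dissipation produced by one interacting agent `Z` on the pair `X`, `Y`. -/
lemma le_re_trace_lohe_interaction {X Y Z V : Matrix (Fin d) (Fin d) ℂ} (hX : Xᴴ * X = 1)
    (hY : Yᴴ * Y = 1) (hZ : Zᴴ * Z = 1) (hV : Vᴴ * V = 1) {m : ℝ}
    (hXZ : frobNorm (X - Z) ^ 2 ≤ m) (hYZ : frobNorm (Y - Z) ^ 2 ≤ m) :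
    frobNorm (X - Y) ^ 2 * (2 - m - 2 * frobNorm (V - 1))
      ≤ (Xᴴ * ((V * Z * Yᴴ - Y * Zᴴ * Vᴴ) - (V * Z * Xᴴ - X * Zᴴ * Vᴴ)) * Y).trace.re := by
  have hX' : X * Xᴴ = 1 := mul_eq_one_comm.1 hX
  have hZ' : Z * Zᴴ = 1 := mul_eq_one_comm.1 hZ
  have hV' : V * Vᴴ = 1 := mul_eq_one_comm.1 hV
  have hXs : Xᴴᴴ * Xᴴ = 1 := by rwa [conjTranspose_conjTranspose]
  have hZs : Zᴴᴴ * Zᴴ = 1 := by rwa [conjTranspose_conjTranspose]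
  have hVs : Vᴴᴴ * Vᴴ = 1 := by rwa [conjTranspose_conjTranspose]
  have unit_mul {C D : Matrix (Fin d) (Fin d) ℂ} (hC : Cᴴ * C = 1) (hD : Dᴴ * D = 1) :
      (C * D)ᴴ * (C * D) = 1 := by
    rw [conjTranspose_mul, Matrix.mul_assoc, ← Matrix.mul_assoc Cᴴ, hC, Matrix.one_mul, hD]
  set A := Xᴴ * (V * Z) with hA_def
  set B := (Zᴴ * Vᴴ) * Y with hB_def
  have hA : Aᴴ * A = 1 := unit_mul hXs (unit_mul hV hZ)
  have hB : Bᴴ * B = 1 := unit_mul (unit_mul hZs hVs) hY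
  have hAB : A * B = Xᴴ * Y := by
    have e : A * B = Xᴴ * (V * (Z * Zᴴ) * Vᴴ) * Y := by
      simp only [hA_def, hB_def, Matrix.mul_assoc]
    rw [e, hZ', Matrix.mul_one, hV', Matrix.mul_one]
  have hsplit : Xᴴ * ((V * Z * Yᴴ - Y * Zᴴ * Vᴴ) - (V * Z * Xᴴ - X * Zᴴ * Vᴴ)) * Y
      = A + B - A * B * B - A * (A * B) := by
    have e : Xᴴ * ((V * Z * Yᴴ - Y * Zᴴ * Vᴴ) - (V * Z * Xᴴ - X * Zᴴ * Vᴴ)) * Y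
        = A * (Yᴴ * Y) - Xᴴ * Y * B - A * (Xᴴ * Y) + (Xᴴ * X) * B := by
      simp only [hA_def, hB_def]
      noncomm_ring
    rw [e, hY, hX, hAB, Matrix.mul_one, Matrix.one_mul]
    abel
  have hQ : frobNorm (1 - A * B) = frobNorm (X - Y) := by
    rw [hAB, ← hX, ← Matrix.mul_sub, frobNorm_unitary_mul hXs]
  have hA_split : A = Xᴴ * Z + Xᴴ * ((V - 1) * Z) := by
    rw [hA_def]
    noncomm_ring
  have hB_split : B = Zᴴ * Y + Zᴴ * ((V - 1)ᴴ * Y) := by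
    rw [hB_def, conjTranspose_sub, conjTranspose_one]
    noncomm_ring
  have bA := re_trace_conj_unitary_add_ge (unit_mul hXs hZ) (Xᴴ * ((V - 1) * Z)) (1 - A * B)
  have bB := re_trace_conj_unitary_add_ge (unit_mul hZs hY) (Zᴴ * ((V - 1)ᴴ * Y)) (1 - A * B)
  have nA : frobNorm (Xᴴ * Z - 1) = frobNorm (X - Z) := by
    rw [← hX, ← Matrix.mul_sub, frobNorm_unitary_mul hXs, frobNorm_sub_comm]
  have nB : frobNorm (Zᴴ * Y - 1) = frobNorm (Y - Z) := by
    rw [← hZ, ← Matrix.mul_sub, frobNorm_unitary_mul hZs]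
  rw [← hA_split, hQ, nA, frobNorm_unitary_mul hXs, frobNorm_mul_unitary hZ] at bA
  rw [← hB_split, hQ, nB, frobNorm_unitary_mul hZs, frobNorm_mul_unitary hY,
    frobNorm_conjTranspose] at bB
  rw [hsplit, re_trace_interaction hA hB]
  nlinarith [sq_nonneg (frobNorm (X - Y)),
    mul_le_mul_of_nonneg_left hXZ (sq_nonneg (frobNorm (X - Y))),
    mul_le_mul_of_nonneg_left hYZ (sq_nonneg (frobNorm (X - Y)))]

end Frobenius

section Flow

variable {d : ℕ}

lemma hasDerivAt_conjTranspose_mul_apply {F G : ℝ → Matrix (Fin d) (Fin d) ℂ}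
    {F' G' : Matrix (Fin d) (Fin d) ℂ} {t : ℝ}
    (hF : ∀ a b, HasDerivAt (fun s => F s a b) (F' a b) t)
    (hG : ∀ a b, HasDerivAt (fun s => G s a b) (G' a b) t) (a b : Fin d) :
    HasDerivAt (fun s => ((F s)ᴴ * G s) a b) ((F'ᴴ * G t + (F t)ᴴ * G') a b) t := by
  simp only [mul_apply, Matrix.add_apply, conjTranspose_apply, ← sum_add_distrib]
  exact HasDerivAt.fun_sum fun k _ => (hF k a).star.mul (hG k b)

lemma hasDerivAt_re_trace {F : ℝ → Matrix (Fin d) (Fin d) ℂ} {F' : Matrix (Fin d) (Fin d) ℂ}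
    {t : ℝ} (hF : ∀ a b, HasDerivAt (fun s => F s a b) (F' a b) t) :
    HasDerivAt (fun s => (F s).trace.re) F'.trace.re t :=
  (Complex.reCLM.hasFDerivAt.comp_hasDerivAt t
    (HasDerivAt.fun_sum (u := univ) fun i _ => hF i i) :)

/-- A linear flow with skew-Hermitian generator preserves `Uᴴ * U`. -/
lemma conjTranspose_mul_self_eq_of_skew {U K : ℝ → Matrix (Fin d) (Fin d) ℂ}
    (hU : ∀ t, 0 ≤ t → ∀ a b, HasDerivAt (fun s => U s a b) ((K t * U t) a b) t)
    (hK : ∀ t, (K t)ᴴ = -K t) {t : ℝ} (ht : 0 ≤ t) :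
    (U t)ᴴ * U t = (U 0)ᴴ * U 0 := by
  ext a b
  have hd (s : ℝ) (hs : 0 ≤ s) : HasDerivAt (fun s => ((U s)ᴴ * U s) a b) 0 s := by
    convert hasDerivAt_conjTranspose_mul_apply (hU s hs) (hU s hs) a b using 1
    rw [conjTranspose_mul, hK]
    simp [Matrix.mul_assoc]
  exact constant_of_has_deriv_right_zero
    (fun s hs => (hd s hs.1).continuousAt.continuousWithinAt)
    (fun s hs => (hd s hs.1).hasDerivWithinAt) t ⟨ht, le_rfl⟩

end Flow

section Decay

lemma antitoneOn_of_hasDerivAt_nonpos {f f' : ℝ → ℝ} {D : Set ℝ} (hD : Convex ℝ D)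
    (hf : ∀ t ∈ D, HasDerivAt f (f' t) t) (hf' : ∀ t ∈ interior D, f' t ≤ 0) :
    AntitoneOn f D :=
  antitoneOn_of_deriv_nonpos hD (fun t ht => (hf t ht).continuousAt.continuousWithinAt)
    (fun t ht => (hf t (interior_subset ht)).differentiableAt.differentiableWithinAt)
    fun t ht => (hf t (interior_subset ht)).deriv ▸ hf' t ht

lemma forall_lt_of_deriv_nonpos_of_le {ι : Type*} [Finite ι] {E E' : ι → ℝ → ℝ} {m : ℝ}
    (hE : ∀ p t, 0 ≤ t → HasDerivAt (E p) (E' p t) t) (h0 : ∀ p, E p 0 < m)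
    (hE' : ∀ t, 0 ≤ t → (∀ q, E q t ≤ m) → ∀ p, E' p t ≤ 0) {t : ℝ} (ht : 0 ≤ t) (p : ι) :
    E p t < m := by
  by_contra! hpt
  have hcont (q : ι) : ContinuousOn (E q) (Set.Icc 0 t) := fun s hs =>
    (hE q s hs.1).continuousAt.continuousWithinAt
  have hclosed : IsClosed (⋃ q, Set.Icc 0 t ∩ E q ⁻¹' Set.Ici m) :=
    isClosed_iUnion_of_finite fun q =>
      (hcont q).preimage_isClosed_of_isClosed isClosed_Icc isClosed_Ici
  have hcomp : IsCompact (⋃ q, Set.Icc 0 t ∩ E q ⁻¹' Set.Ici m) :=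
    isCompact_Icc.of_isClosed_subset hclosed (Set.iUnion_subset fun _ => Set.inter_subset_left)
  obtain ⟨τ, hτ, hmin⟩ := hcomp.exists_isLeast ⟨t, Set.mem_iUnion.2 ⟨p, ⟨ht, le_rfl⟩, hpt⟩⟩
  obtain ⟨q, ⟨hτ0, hτt⟩, hqτ⟩ := Set.mem_iUnion.1 hτ
  have hbefore (s : ℝ) (hs : s ∈ Set.Ioo 0 τ) (r : ι) : E r s ≤ m := by
    by_contra! h
    exact hs.2.not_ge (hmin (Set.mem_iUnion.2 ⟨r, ⟨hs.1.le, hs.2.le.trans hτt⟩, h.le⟩))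
  have hanti : AntitoneOn (E q) (Set.Icc 0 τ) :=
    antitoneOn_of_hasDerivAt_nonpos (convex_Icc 0 τ) (fun s hs => hE q s hs.1) fun s hs => by
      rw [interior_Icc] at hs
      exact hE' s hs.1.le (hbefore s hs) q
  exact ((hanti ⟨le_rfl, hτ0⟩ ⟨hτ0, le_rfl⟩ hτ0).trans_lt (h0 q)).not_ge hqτ

lemma tendsto_zero_of_deriv_le_neg_mul {f f' : ℝ → ℝ} {c : ℝ} (hc : 0 < c)
    (hf : ∀ t, 0 ≤ t → HasDerivAt f (f' t) t) (hf0 : ∀ t, 0 ≤ t → 0 ≤ f t)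
    (hf' : ∀ t, 0 ≤ t → f' t ≤ -(c * f t)) :
    Filter.Tendsto f Filter.atTop (nhds 0) := by
  have hanti : AntitoneOn (fun t => Real.exp (c * t) * f t) (Set.Ici 0) := by
    refine antitoneOn_of_hasDerivAt_nonpos (convex_Ici 0)
      (fun t ht => (((hasDerivAt_id t).const_mul c).exp).mul (hf t ht)) fun t ht => ?_
    have ht' : 0 ≤ t := interior_subset ht
    have := mul_le_mul_of_nonneg_left (hf' t ht') (Real.exp_nonneg (c * t))
    simp only [id, mul_one]
    linarith
  have hlim : Filter.Tendsto (fun t => f 0 * Real.exp (-(c * t))) Filter.atTop (nhds 0) := by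
    simpa using (Real.tendsto_exp_neg_atTop_nhds_zero.comp
      (Filter.tendsto_id.const_mul_atTop hc)).const_mul (f 0)
  refine squeeze_zero' (Filter.eventually_atTop.2 ⟨0, hf0⟩) ?_ hlim
  filter_upwards [Filter.eventually_ge_atTop 0] with t ht
  have := hanti Set.self_mem_Ici ht ht
  simp only [mul_zero, Real.exp_zero, one_mul] at this
  rwa [Real.exp_neg, ← div_eq_mul_inv, le_div_iff₀ (Real.exp_pos _), mul_comm]

end Decay

/-- The skew-Hermitian generator of the Lohe matrix flow. -/
noncomputable def loheGenerator {d N : ℕ} (κ : ℝ) (H V : Matrix (Fin d) (Fin d) ℂ)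
    (U : Fin N → Matrix (Fin d) (Fin d) ℂ) (j : Fin N) : Matrix (Fin d) (Fin d) ℂ :=
  (-Complex.I) • H + ((κ / (2 * N) : ℝ)) • ∑ k, (V * U k * (U j)ᴴ - U j * (U k)ᴴ * Vᴴ)

lemma conjTranspose_loheGenerator {d N : ℕ} (κ : ℝ) {H : Matrix (Fin d) (Fin d) ℂ}
    (hH : H.IsHermitian) (V : Matrix (Fin d) (Fin d) ℂ)
    (U : Fin N → Matrix (Fin d) (Fin d) ℂ) (j : Fin N) :
    (loheGenerator κ H V U j)ᴴ = -loheGenerator κ H V U j := by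
  have hS : (∑ k, (V * U k * (U j)ᴴ - U j * (U k)ᴴ * Vᴴ))ᴴ
      = -∑ k, (V * U k * (U j)ᴴ - U j * (U k)ᴴ * Vᴴ) := by
    rw [conjTranspose_sum, ← sum_neg_distrib]
    simp [Matrix.mul_assoc]
  rw [loheGenerator, conjTranspose_add, conjTranspose_smul, conjTranspose_smul, hS, hH.eq, neg_add,
    smul_neg]
  simp

lemma deriv_sq_frobNorm_le {d N : ℕ} (hN : 1 ≤ N) {κ : ℝ} (hκ : 0 < κ)
    {H V : Matrix (Fin d) (Fin d) ℂ} (hV : Vᴴ * V = 1)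
    {U : Fin N → Matrix (Fin d) (Fin d) ℂ} (hU : ∀ j, (U j)ᴴ * U j = 1) {m : ℝ}
    (hm : ∀ i j, frobNorm (U i - U j) ^ 2 ≤ m) (i j : Fin N) :
    -(2 * ((U i)ᴴ * (loheGenerator κ H V U j - loheGenerator κ H V U i) * U j).trace.re)
      ≤ -(κ * (2 - m - 2 * frobNorm (V - 1)) * frobNorm (U i - U j) ^ 2) := by
  have hN0 : (N : ℝ) ≠ 0 := by positivity
  have hsum := sum_le_sum fun k (_ : k ∈ univ) =>
    le_re_trace_lohe_interaction (hU i) (hU j) (hU k) hV (hm i k) (hm j k)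
  rw [sum_const, card_univ, Fintype.card_fin, nsmul_eq_mul] at hsum
  have hgen : ((U i)ᴴ * (loheGenerator κ H V U j - loheGenerator κ H V U i) * U j).trace.re
      = κ / (2 * N) * ∑ k, ((U i)ᴴ * ((V * U k * (U j)ᴴ - U j * (U k)ᴴ * Vᴴ)
          - (V * U k * (U i)ᴴ - U i * (U k)ᴴ * Vᴴ)) * U j).trace.re := by
    rw [loheGenerator, loheGenerator, add_sub_add_left_eq_sub, ← smul_sub, ← sum_sub_distrib,
      Matrix.mul_smul, Matrix.smul_mul, trace_smul, Complex.smul_re, smul_eq_mul,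
      Matrix.mul_sum, Matrix.sum_mul, trace_sum, Complex.re_sum]
  rw [hgen]
  have hmul := mul_le_mul_of_nonneg_left hsum (by positivity : 0 ≤ κ / (2 * N))
  have e : κ / (2 * N) * (N * (frobNorm (U i - U j) ^ 2 * (2 - m - 2 * frobNorm (V - 1))))
      = κ / 2 * (frobNorm (U i - U j) ^ 2 * (2 - m - 2 * frobNorm (V - 1))) := by
    field_simp
  rw [e] at hmul
  linarith

/-- **Complete aggregation for the Lohe matrix model with identical Hamiltonian
and frustration.** If the unitary frustration matrix `V` satisfies
`‖V - I‖_F < 2/3` and the unitary initial data satisfy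
`max_{i,j} ‖U_i(0) - U_j(0)‖_F < √(2 - 3‖V - I‖_F)`, then
`max_{i,j} ‖U_i(t) - U_j(t)‖_F → 0` as `t → ∞`. -/
theorem lohe_matrix_complete_aggregation {d N : ℕ} (hN : 1 ≤ N)
    (κ : ℝ) (hκ : 0 < κ)
    (H : Matrix (Fin d) (Fin d) ℂ) (hH : H.IsHermitian)
    (V : Matrix (Fin d) (Fin d) ℂ) (hV : V ∈ Matrix.unitaryGroup (Fin d) ℂ)
    (U : Fin N → ℝ → Matrix (Fin d) (Fin d) ℂ)
    (hode : ∀ (j : Fin N) (t : ℝ), 0 ≤ t → ∀ (a b : Fin d),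
      HasDerivAt (fun s => U j s a b)
        (((-Complex.I) • (H * U j t)
          + ((κ / (2 * N) : ℝ)) •
            ((∑ k : Fin N, (V * U k t * (U j t)ᴴ - U j t * (U k t)ᴴ * Vᴴ)) * U j t)) a b) t)
    (hinit_unitary : ∀ j : Fin N, U j 0 ∈ Matrix.unitaryGroup (Fin d) ℂ)
    (hVsmall : frobNorm (V - 1) < 2 / 3)
    (hinit : ∀ i j : Fin N,
      frobNorm (U i 0 - U j 0) < Real.sqrt (2 - 3 * frobNorm (V - 1))) :
    ∀ i j : Fin N,
      Filter.Tendsto (fun t : ℝ => frobNorm (U i t - U j t)) Filter.atTop (nhds 0) := by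
  have hVu : Vᴴ * V = 1 := Matrix.mem_unitaryGroup_iff'.1 hV
  have hflow (j : Fin N) (t : ℝ) (ht : 0 ≤ t) (a b : Fin d) : HasDerivAt (fun s => U j s a b)
      ((loheGenerator κ H V (fun k => U k t) j * U j t) a b) t := by
    convert hode j t ht a b using 2
    rw [loheGenerator, Matrix.add_mul, Matrix.smul_mul, Matrix.smul_mul]
  have hunit (t : ℝ) (ht : 0 ≤ t) (j : Fin N) : (U j t)ᴴ * U j t = 1 :=
    (conjTranspose_mul_self_eq_of_skew (hflow j)
      (fun t => conjTranspose_loheGenerator κ hH V (fun k => U k t) j) ht).trans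
      (Matrix.mem_unitaryGroup_iff'.1 (hinit_unitary j))
  set E : Fin N × Fin N → ℝ → ℝ := fun p t => 2 * d - 2 * ((U p.1 t)ᴴ * U p.2 t).trace.re
  set E' : Fin N × Fin N → ℝ → ℝ := fun p t =>
    -(2 * ((U p.1 t)ᴴ * (loheGenerator κ H V (fun k => U k t) p.2
      - loheGenerator κ H V (fun k => U k t) p.1) * U p.2 t).trace.re)
  have hE_eq (p : Fin N × Fin N) (t : ℝ) (ht : 0 ≤ t) :
      frobNorm (U p.1 t - U p.2 t) ^ 2 = E p t := sq_frobNorm_sub (hunit t ht _) (hunit t ht _)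
  have hE (p : Fin N × Fin N) (t : ℝ) (ht : 0 ≤ t) : HasDerivAt (E p) (E' p t) t := by
    have h := ((hasDerivAt_re_trace (hasDerivAt_conjTranspose_mul_apply
      (hflow p.1 t ht) (hflow p.2 t ht))).const_mul 2).const_sub (2 * (d : ℝ))
    refine h.congr_deriv ?_
    rw [conjTranspose_mul, conjTranspose_loheGenerator κ hH]
    congr 4
    noncomm_ring
  have hV0 := frobNorm_nonneg (V - 1)
  obtain ⟨m, hm, hm0⟩ : ∃ m < 2 - 3 * frobNorm (V - 1), ∀ p, E p 0 < m := by
    have h (p : Fin N × Fin N) : E p 0 < 2 - 3 * frobNorm (V - 1) := by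
      rw [← hE_eq p 0 le_rfl, ← Real.lt_sqrt (frobNorm_nonneg _)]
      exact hinit p.1 p.2
    have hev : ∀ᶠ m in nhdsWithin (2 - 3 * frobNorm (V - 1)) (Set.Iio (2 - 3 * frobNorm (V - 1))),
        ∀ p, E p 0 < m :=
      Filter.eventually_all.2 fun p =>
        (eventually_gt_nhds (h p)).filter_mono nhdsWithin_le_nhds
    exact (eventually_mem_nhdsWithin.and hev).exists
  set c := κ * (2 - m - 2 * frobNorm (V - 1))
  have hc : 0 < c := mul_pos hκ (by linarith)
  have hdecay (t : ℝ) (ht : 0 ≤ t) (hle : ∀ q, E q t ≤ m) (p : Fin N × Fin N) :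
      E' p t ≤ -(c * E p t) := by
    rw [← hE_eq p t ht]
    exact deriv_sq_frobNorm_le hN hκ hVu (hunit t ht)
      (fun i j => (hE_eq (i, j) t ht).trans_le (hle (i, j))) p.1 p.2
  have hbound (t : ℝ) (ht : 0 ≤ t) (p : Fin N × Fin N) : E p t < m := by
    refine forall_lt_of_deriv_nonpos_of_le hE hm0 (fun s hs hle q => ?_) ht p
    have : 0 ≤ c * E q s := mul_nonneg hc.le ((hE_eq q s hs).symm ▸ sq_nonneg _)
    linarith [hdecay s hs hle q]
  intro i j
  have hlim := tendsto_zero_of_deriv_le_neg_mul hc (hE (i, j))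
    (fun t ht => hE_eq (i, j) t ht ▸ sq_nonneg _)
    (fun t ht => hdecay t ht (fun q => (hbound t ht q).le) (i, j))
  have hsqrt := hlim.sqrt
  rw [Real.sqrt_zero] at hsqrt
  refine hsqrt.congr' ?_
  filter_upwards [Filter.eventually_ge_atTop 0] with t ht
  rw [← hE_eq (i, j) t ht, Real.sqrt_sq (frobNorm_nonneg _)]
end

section
/- Let G = {g_1,…,g_N} be a finite group with N = |G| and let ϱ : G → U(d) be a group homomorphism into the d×d complex unitary group. Then the configuration U_i := ϱ(g_i), i = 1,…,N, is an equilibrium of the Lohe matrix model with zero Hamiltonian and trivial frustration V = I_d; that is, for every i = 1,…,N, Σ_{k=1}^N ( U_k U_i* − U_i U_k* ) = 0. -/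
open Matrix Finset

/-- **Images of group homomorphisms into `U(d)` are equilibria of the Lohe matrix
model with zero Hamiltonian and trivial frustration `V = I`.** If
`G = {g_1, …, g_N}` is a finite group with `N = |G|`, `ϱ : G → U(d)` a group
homomorphism, and `U_i := ϱ(g_i)`, then for every `i`,
`∑_k (U_k U_i* - U_i U_k*) = 0`. -/
theorem lohe_matrix_group_hom_equilibrium {G : Type*} [Group G] [Fintype G]
    {d N : ℕ} (hN : N = Fintype.card G) (g : Fin N ≃ G)
    (ϱ : G →* Matrix.unitaryGroup (Fin d) ℂ)
    (U : Fin N → Matrix (Fin d) (Fin d) ℂ)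
    (hU : ∀ i : Fin N, U i = (ϱ (g i) : Matrix (Fin d) (Fin d) ℂ)) :
    ∀ i : Fin N, ∑ k : Fin N, (U k * star (U i) - U i * star (U k)) = 0 := by
  intro i
  have hmul (a b : G) : (ϱ a : Matrix (Fin d) (Fin d) ℂ) * star (ϱ b : Matrix (Fin d) (Fin d) ℂ) =
      (ϱ (a * b⁻¹) : Matrix (Fin d) (Fin d) ℂ) := by
    rw [map_mul, map_inv]
    rfl
  simp only [hU, hmul, Finset.sum_sub_distrib]
  rw [g.sum_comp fun x => (ϱ (x * (g i)⁻¹) : Matrix (Fin d) (Fin d) ℂ),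
    g.sum_comp fun x => (ϱ (g i * x⁻¹) : Matrix (Fin d) (Fin d) ℂ), sub_eq_zero]
  exact (Equiv.sum_comp (Equiv.mulRight (g i)⁻¹)
      fun x => (ϱ x : Matrix (Fin d) (Fin d) ℂ)).trans
    (Equiv.sum_comp ((Equiv.inv G).trans (Equiv.mulLeft (g i)))
      fun x => (ϱ x : Matrix (Fin d) (Fin d) ℂ)).symm
end
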